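/- (Rejected videos never block the final matching) Suppose station s rejects video v at some step k (i.e., s ∈ Cv v (A v k) and v ∉ Cs s (P s k)), and let K ≥ k be a step at which no rejection occurs (for all v' ∈ V and s' ∈ M, s' ∈ Cv v' (A v' K) implies v' ∈ Cs s' (P s' K)). Let μM s = Cs s (P s K) be the set of videos matched to s at step K. Then v ∉ Cs s (μM s ∪ {v}), i.e., station s does not wish to add the rejected video v to its final cache. -/

import Mathlib

universe u

/-- A choice function on a finite type `α`: selects a subset of each finite set,
satisfying substitutability and irrelevance of rejected alternatives (IRC). -/
structure ChoiceFun (α : Type u) [Fintype α] [DecidableEq α] where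
  C : Finset α → Finset α
  choice_subset : ∀ S : Finset α, C S ⊆ S
  substitutable : ∀ {x : α} {S T : Finset α}, x ∈ C S → x ∈ T → T ⊆ S → x ∈ C T
  irc : ∀ {S T : Finset α}, C T ⊆ S → S ⊆ T → C S = C T

variable {M V : Type u} [Fintype M] [DecidableEq M] [Fintype V] [DecidableEq V]

/-- Proposal set of station `s` given current offer sets `A`:
the videos `v` that propose to `s`, i.e. with `s ∈ Cv v (A v)`. -/
def propSet (Cv : V → ChoiceFun M) (A : V → Finset M) (s : M) : Finset V :=
  Finset.univ.filter fun v => s ∈ (Cv v).C (A v)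

/-- Offer sets of the deferred-acceptance algorithm: `offers Cv Cs k v = A v k`. -/
def offers (Cv : V → ChoiceFun M) (Cs : M → ChoiceFun V) : ℕ → V → Finset M
  | 0 => fun _ => Finset.univ
  | k + 1 => fun v =>
      offers Cv Cs k v \
        (Finset.univ.filter fun s =>
          s ∈ (Cv v).C (offers Cv Cs k v) ∧
            v ∉ (Cs s).C (propSet Cv (offers Cv Cs k) s))

/-- Proposal set of station `s` at step `k`: `proposals Cv Cs k s = P s k`. -/
def proposals (Cv : V → ChoiceFun M) (Cs : M → ChoiceFun V) (k : ℕ) (s : M) : Finset V :=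
  propSet Cv (offers Cv Cs k) s

/-- Station `s` rejects video `v` at step `k`. -/
def rejects (Cv : V → ChoiceFun M) (Cs : M → ChoiceFun V) (k : ℕ) (s : M) (v : V) : Prop :=
  s ∈ (Cv v).C (offers Cv Cs k v) ∧ v ∉ (Cs s).C (proposals Cv Cs k s)

/-- A video held by a station keeps proposing to it at the next step. -/
lemma choice_proposals_subset_succ (Cv : V → ChoiceFun M) (Cs : M → ChoiceFun V)
    (s : M) (k : ℕ) :
    (Cs s).C (proposals Cv Cs k s) ⊆ proposals Cv Cs (k + 1) s := by
  intro w hw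
  have hP : s ∈ (Cv w).C (offers Cv Cs k w) := by
    simpa [proposals, propSet] using (Cs s).choice_subset _ hw
  have hmem : s ∈ offers Cv Cs (k + 1) w := by
    have hheld : w ∈ (Cs s).C (propSet Cv (offers Cv Cs k) s) := hw
    simp [offers, (Cv w).choice_subset _ hP, hheld]
  have hnext : s ∈ (Cv w).C (offers Cv Cs (k + 1) w) :=
    (Cv w).substitutable hP hmem Finset.sdiff_subset
  simpa [proposals, propSet] using hnext

/-- If `v` is not chosen from `S ∪ {v}`, it is not chosen from `T ∪ {v}` for any `T` containing
the elements chosen from `S`. -/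
lemma ChoiceFun.notMem_choice_union_singleton {α : Type u} [Fintype α] [DecidableEq α]
    (F : ChoiceFun α) {v : α} {S T : Finset α} (hv : v ∉ F.C (S ∪ {v})) (hST : F.C S ⊆ T) :
    v ∉ F.C (T ∪ {v}) := by
  have hle : S ∪ {v} ⊆ S ∪ (T ∪ {v}) :=
    Finset.union_subset_union_right Finset.subset_union_right
  have hU : F.C (S ∪ (T ∪ {v})) ⊆ T ∪ {v} := by
    intro x hx
    rcases Finset.mem_union.1 (F.choice_subset _ hx) with h | h
    · exact Finset.mem_union_left _
        (hST (F.substitutable hx h Finset.subset_union_left))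
    · exact h
  rw [F.irc hU Finset.subset_union_right]
  exact fun h => hv (F.substitutable h (by simp) hle)

/-- **Rejected videos never block the final matching.** If `s` rejects `v` at step `k` and
no rejection occurs at step `K ≥ k`, then `v ∉ Cs s (μM s ∪ {v})` where `μM s = Cs s (P s K)`. -/
theorem rejected_never_blocks (Cv : V → ChoiceFun M) (Cs : M → ChoiceFun V)
    (v : V) (s : M) (k K : ℕ) (hkK : k ≤ K)
    (hprop : s ∈ (Cv v).C (offers Cv Cs k v))
    (hrej : v ∉ (Cs s).C (proposals Cv Cs k s))
    (hno : ∀ (v' : V) (s' : M),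
      s' ∈ (Cv v').C (offers Cv Cs K v') → v' ∈ (Cs s').C (proposals Cv Cs K s')) :
    v ∉ (Cs s).C ((Cs s).C (proposals Cv Cs K s) ∪ {v}) := by
  have hinv : v ∉ (Cs s).C (proposals Cv Cs K s ∪ {v}) := by
    clear hno
    induction K, hkK using Nat.le_induction with
    | base =>
      have hv : v ∈ proposals Cv Cs k s := by simpa [proposals, propSet] using hprop
      rwa [Finset.union_eq_left.2 (Finset.singleton_subset_iff.2 hv)]
    | succ j _ ih =>
      exact (Cs s).notMem_choice_union_singleton ih (choice_proposals_subset_succ Cv Cs s j)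
  have hfix : (Cs s).C (proposals Cv Cs K s) = proposals Cv Cs K s := by
    refine ((Cs s).choice_subset _).antisymm fun w hw => hno w s ?_
    simpa [proposals, propSet] using hw
  rwa [hfix]
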